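/- arXiv:1805.06868 — 5 statements merged into one kernel-verified Lean document; each statement's English description precedes it below -/
import Mathlib

section
/- Let r, s be real numbers with r ≠ s, and let φ(u) = γ(u) = π^{−1/4} exp(−u²/2). Define Ψ(x,y) = √|r−s| · φ(r x + s y) · γ(x + y). Then there exist functions f, g : ℝ → ℂ with Ψ(x,y) = f(x)·g(y) for all x, y ∈ ℝ if and only if r·s = −1. -/
open MeasureTheory

/-- The unit-width `L²`-normalized Gaussian `π^{-1/4} e^{-u²/2}`, viewed as a
complex-valued function. -/
noncomputable def unitGaussian (u : ℝ) : ℂ :=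
  ((Real.pi ^ (-(1 / 4 : ℝ)) * Real.exp (-u ^ 2 / 2) : ℝ) : ℂ)

/-- A product of two unit Gaussians is a positive constant times a single exponential. -/
lemma unitGaussian_mul (u v : ℝ) :
    unitGaussian u * unitGaussian v =
      (((Real.pi ^ (-(1 / 4 : ℝ))) ^ 2 * Real.exp (-(u ^ 2 + v ^ 2) / 2) : ℝ) : ℂ) := by
  have h : -(u ^ 2 + v ^ 2) / 2 = -u ^ 2 / 2 + -v ^ 2 / 2 := by ring
  rw [h, Real.exp_add, unitGaussian, unitGaussian, ← Complex.ofReal_mul]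
  congr 1
  ring

/-- For Gaussian phase-matching function `φ` and pump function `γ`
(both equal to `π^{-1/4} e^{-u²/2}`), the joint spectral amplitude
`Ψ(x,y) = √|r−s| · φ(r x + s y) · γ(x + y)` factorizes as `f(x)·g(y)`
if and only if `r·s = −1`. -/
theorem gaussian_JSA_separable_iff (r s : ℝ) (hrs : r ≠ s)
    (Ψ : ℝ → ℝ → ℂ)
    (hΨ : ∀ x y : ℝ, Ψ x y =
      (Real.sqrt |r - s| : ℂ) * unitGaussian (r * x + s * y) * unitGaussian (x + y)) :
    (∃ f g : ℝ → ℂ, ∀ x y : ℝ, Ψ x y = f x * g y) ↔ r * s = -1 := by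
  obtain ⟨K, hK, hΨK⟩ : ∃ K : ℝ, 0 < K ∧ ∀ x y : ℝ, Ψ x y =
      ((K * Real.exp (-((r * x + s * y) ^ 2 + (x + y) ^ 2) / 2) : ℝ) : ℂ) := by
    refine ⟨Real.sqrt |r - s| * (Real.pi ^ (-(1 / 4 : ℝ))) ^ 2, ?_, fun x y => ?_⟩
    · have h : 0 < |r - s| := abs_pos.mpr (sub_ne_zero.mpr hrs)
      have := Real.pi_pos
      positivity
    · rw [hΨ, mul_assoc, unitGaussian_mul, ← Complex.ofReal_mul, mul_assoc]
  constructor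
  · rintro ⟨f, g, hfg⟩
    have h : Ψ 1 1 * Ψ 0 0 = Ψ 1 0 * Ψ 0 1 := by
      simp only [hfg]
      ring
    simp only [hΨK, ← Complex.ofReal_mul, Complex.ofReal_inj] at h
    rw [mul_mul_mul_comm, mul_mul_mul_comm K _ K, ← Real.exp_add, ← Real.exp_add] at h
    have h' := Real.exp_injective (mul_left_cancel₀ (mul_pos hK hK).ne' h)
    linarith
  · intro h
    refine ⟨fun x => ((K * Real.exp (-((r ^ 2 + 1) * x ^ 2) / 2) : ℝ) : ℂ),
      fun y => ((Real.exp (-((s ^ 2 + 1) * y ^ 2) / 2) : ℝ) : ℂ), fun x y => ?_⟩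
    rw [hΨK, ← Complex.ofReal_mul, mul_assoc, ← Real.exp_add]
    congr 3
    linear_combination (-x * y) * h
end

section
/- Let r, s be real numbers with r ≠ s, let φ(u) = γ(u) = π^{−1/4} exp(−u²/2), and define Ψ(x,y) = √|r−s| · φ(r x + s y) · γ(x + y). Then the purity of Ψ satisfies P{Ψ} = |r−s| / √((1+r²)(1+s²)). -/
open MeasureTheory

/-- The marginal kernel `ρ(x,x') = ∫ Ψ(x,y) conj(Ψ(x',y)) dy` of a two-variable
amplitude `Ψ`. -/
noncomputable def marginalKernel (Ψ : ℝ → ℝ → ℂ) (x x' : ℝ) : ℂ :=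
  ∫ y : ℝ, Ψ x y * (starRingEnd ℂ) (Ψ x' y)

/-- The purity `P{Ψ} = ∫∫ |ρ(x,x')|² dx dx'`. -/
noncomputable def purity (Ψ : ℝ → ℝ → ℂ) : ℝ :=
  ∫ x : ℝ, ∫ x' : ℝ, ‖marginalKernel Ψ x x'‖ ^ 2

theorem integral_exp_neg_quadratic {a : ℝ} (ha : 0 < a) (b c : ℝ) :
    ∫ y : ℝ, Real.exp (-(a * y ^ 2 + b * y + c)) =
      Real.sqrt (Real.pi / a) * Real.exp (b ^ 2 / (4 * a) - c) := by
  have h : ∀ y : ℝ, Real.exp (-(a * y ^ 2 + b * y + c)) =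
      Real.exp (-a * (y + b / (2 * a)) ^ 2) * Real.exp (b ^ 2 / (4 * a) - c) := by
    intro y
    rw [← Real.exp_add]
    congr 1
    field_simp
    ring
  simp_rw [h]
  rw [integral_mul_const, integral_add_right_eq_self (fun y : ℝ => Real.exp (-a * y ^ 2)),
    integral_gaussian]

theorem unitGaussian_mul_unitGaussian (u v : ℝ) :
    unitGaussian u * unitGaussian v =
      (((Real.sqrt Real.pi)⁻¹ * Real.exp (-(u ^ 2 + v ^ 2) / 2) : ℝ) : ℂ) := by
  have hpi : Real.pi ^ (-(1 / 4 : ℝ)) * Real.pi ^ (-(1 / 4 : ℝ)) = (Real.sqrt Real.pi)⁻¹ := by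
    rw [← Real.rpow_add Real.pi_pos, Real.sqrt_eq_rpow, ← Real.rpow_neg Real.pi_pos.le]
    norm_num
  have hexp : Real.exp (-(u ^ 2 + v ^ 2) / 2) = Real.exp (-u ^ 2 / 2) * Real.exp (-v ^ 2 / 2) := by
    rw [← Real.exp_add]
    congr 1
    ring
  rw [unitGaussian, unitGaussian, ← Complex.ofReal_mul, ← hpi, hexp]
  congr 1
  ring

/-- The marginal kernel of the Gaussian amplitude is again Gaussian. -/
theorem marginalKernel_gaussian (r s : ℝ) (Ψ : ℝ → ℝ → ℂ)
    (hΨ : ∀ x y : ℝ, Ψ x y =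
      (Real.sqrt |r - s| : ℂ) * unitGaussian (r * x + s * y) * unitGaussian (x + y)) (x x' : ℝ) :
    marginalKernel Ψ x x' =
      ((|r - s| / Real.pi * (Real.sqrt (Real.pi / (1 + s ^ 2)) *
        Real.exp (((1 + r * s) * (x + x')) ^ 2 / (4 * (1 + s ^ 2)) -
          (1 + r ^ 2) * (x ^ 2 + x' ^ 2) / 2)) : ℝ) : ℂ) := by
  rw [← integral_exp_neg_quadratic (by positivity : 0 < 1 + s ^ 2), ← integral_const_mul,
    ← integral_complex_ofReal, marginalKernel]
  congr 1
  funext y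
  simp only [hΨ, mul_assoc (Real.sqrt _ : ℂ) (unitGaussian _), unitGaussian_mul_unitGaussian,
    ← Complex.ofReal_mul, Complex.conj_ofReal]
  congr 1
  have hd : |r - s| / Real.pi =
      Real.sqrt |r - s| * Real.sqrt |r - s| * ((Real.sqrt Real.pi)⁻¹ * (Real.sqrt Real.pi)⁻¹) := by
    rw [← mul_inv, Real.mul_self_sqrt (abs_nonneg _), Real.mul_self_sqrt Real.pi_pos.le,
      div_eq_mul_inv]
  have he : Real.exp (-((1 + s ^ 2) * y ^ 2 + (1 + r * s) * (x + x') * y +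
        (1 + r ^ 2) * (x ^ 2 + x' ^ 2) / 2)) =
      Real.exp (-((r * x + s * y) ^ 2 + (x + y) ^ 2) / 2) *
        Real.exp (-((r * x' + s * y) ^ 2 + (x' + y) ^ 2) / 2) := by
    rw [← Real.exp_add]
    congr 1
    ring
  rw [hd, he]
  ring

theorem integral_integral_exp_neg_symm_quadratic {a k : ℝ} (ha : 0 < a) (hk : 0 < a ^ 2 - k ^ 2) :
    ∫ x : ℝ, ∫ x' : ℝ, Real.exp (-(a * x' ^ 2 + 2 * k * x * x' + a * x ^ 2)) =
      Real.pi / Real.sqrt (a ^ 2 - k ^ 2) := by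
  have hpos : 0 < (a ^ 2 - k ^ 2) / a := by positivity
  have h : ∀ x : ℝ, Real.exp ((2 * k * x) ^ 2 / (4 * a) - a * x ^ 2) =
      Real.exp (-((a ^ 2 - k ^ 2) / a) * x ^ 2) := by
    intro x
    congr 1
    field_simp
    ring
  simp_rw [integral_exp_neg_quadratic ha, h]
  rw [integral_const_mul, integral_gaussian, ← Real.sqrt_mul (by positivity)]
  have hq : Real.pi / a * (Real.pi / ((a ^ 2 - k ^ 2) / a)) = Real.pi ^ 2 / (a ^ 2 - k ^ 2) := by
    field_simp
  rw [hq, Real.sqrt_div (by positivity), Real.sqrt_sq Real.pi_pos.le]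

/-- For Gaussian phase-matching and pump functions `φ = γ = π^{-1/4} e^{-u²/2}`,
the purity of the joint spectral amplitude
`Ψ(x,y) = √|r−s| · φ(r x + s y) · γ(x + y)` equals `|r−s| / √((1+r²)(1+s²))`. -/
theorem gaussian_JSA_purity (r s : ℝ) (hrs : r ≠ s)
    (Ψ : ℝ → ℝ → ℂ)
    (hΨ : ∀ x y : ℝ, Ψ x y =
      (Real.sqrt |r - s| : ℂ) * unitGaussian (r * x + s * y) * unitGaussian (x + y)) :
    purity Ψ = |r - s| / Real.sqrt ((1 + r ^ 2) * (1 + s ^ 2)) := by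
  have hd : 0 < |r - s| := abs_pos.mpr (sub_ne_zero.mpr hrs)
  have hA : 0 < 1 + s ^ 2 := by positivity
  have hC : 0 < 1 + r ^ 2 := by positivity
  set k : ℝ := -((1 + r * s) ^ 2 / (2 * (1 + s ^ 2))) with hk
  set a : ℝ := 1 + r ^ 2 + k with ha
  have hsq : a ^ 2 - k ^ 2 = (1 + r ^ 2) / (1 + s ^ 2) * |r - s| ^ 2 := by
    rw [sq_abs, ha, hk]
    field_simp
    ring
  have hapos : 0 < a := by
    have : a = ((1 + r ^ 2) * (1 + s ^ 2) + (r - s) ^ 2) / (2 * (1 + s ^ 2)) := by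
      rw [ha, hk]
      field_simp
      ring
    rw [this]
    positivity
  have hnorm : ∀ x x' : ℝ, ‖marginalKernel Ψ x x'‖ ^ 2 =
      |r - s| ^ 2 / (Real.pi * (1 + s ^ 2)) *
        Real.exp (-(a * x' ^ 2 + 2 * k * x * x' + a * x ^ 2)) := by
    intro x x'
    rw [marginalKernel_gaussian r s Ψ hΨ, Complex.norm_real, Real.norm_eq_abs, sq_abs, mul_pow,
      mul_pow, Real.sq_sqrt (by positivity), ← Real.exp_nat_mul, ← mul_assoc]
    congr 1
    · field_simp
    · congr 1
      rw [ha, hk]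
      push_cast
      field_simp
      ring
  simp_rw [purity, hnorm, integral_const_mul]
  rw [integral_integral_exp_neg_symm_quadratic hapos (by rw [hsq]; positivity), hsq,
    Real.sqrt_mul (by positivity), Real.sqrt_sq hd.le, Real.sqrt_div hC.le, Real.sqrt_mul hC.le]
  have hs : Real.sqrt (1 + s ^ 2) ^ 2 = 1 + s ^ 2 := Real.sq_sqrt hA.le
  have hs0 : 0 < Real.sqrt (1 + s ^ 2) := Real.sqrt_pos.mpr hA
  have hr0 : 0 < Real.sqrt (1 + r ^ 2) := Real.sqrt_pos.mpr hC
  field_simp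
  rw [hs]
end

section
/- Let c : ℕ → ℂ satisfy ∑ₙ |cₙ|² = 1 and suppose N := ∑ₙ n·|cₙ|² is finite (i.e., n ↦ n|cₙ|² is summable). Then the series m := ∑ₙ √((n+1)(n+2)) · conj(cₙ) · c_{n+2} converges absolutely and |m| ≤ √(N(N+1)). -/
open scoped ComplexConjugate

/-- **Cauchy-Schwarz inequality** for series of nonnegative square-summable real sequences. -/
theorem Real.summable_mul_and_tsum_mul_le_sqrt {ι : Type*} {f g : ι → ℝ}
    (hf : ∀ i, 0 ≤ f i) (hg : ∀ i, 0 ≤ g i)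
    (hf2 : Summable fun i => f i ^ 2) (hg2 : Summable fun i => g i ^ 2) :
    (Summable fun i => f i * g i) ∧
      ∑' i, f i * g i ≤ √((∑' i, f i ^ 2) * ∑' i, g i ^ 2) := by
  have h := Real.summable_and_inner_le_Lp_mul_Lq_tsum_of_nonneg Real.HolderConjugate.two_two
    hf hg (by simpa only [Real.rpow_two] using hf2) (by simpa only [Real.rpow_two] using hg2)
  simp only [Real.rpow_two, ← Real.sqrt_eq_rpow] at h
  rwa [Real.sqrt_mul (tsum_nonneg fun i => sq_nonneg (f i))]

/-- **Second-moment bound (uncertainty principle).** For number-basis coefficients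
`c : ℕ → ℂ` with `∑|cₙ|² = 1` and finite mean photon number `N = ∑ n|cₙ|²`, the series
`m = ∑ √((n+1)(n+2))·conj(cₙ)·c_{n+2}` converges absolutely and `|m| ≤ √(N(N+1))`. -/
theorem second_moment_bound (c : ℕ → ℂ)
    (hsum : Summable fun n : ℕ => ‖c n‖ ^ 2)
    (hnorm : (∑' n : ℕ, ‖c n‖ ^ 2) = 1)
    (hN : Summable fun n : ℕ => (n : ℝ) * ‖c n‖ ^ 2) :
    Summable (fun n : ℕ =>
      ‖(Real.sqrt (((n : ℝ) + 1) * ((n : ℝ) + 2)) : ℂ) * conj (c n) * c (n + 2)‖) ∧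
    ‖∑' n : ℕ, (Real.sqrt (((n : ℝ) + 1) * ((n : ℝ) + 2)) : ℂ) * conj (c n) * c (n + 2)‖
      ≤ Real.sqrt ((∑' n : ℕ, (n : ℝ) * ‖c n‖ ^ 2) *
          ((∑' n : ℕ, (n : ℝ) * ‖c n‖ ^ 2) + 1)) := by
  have hterm (n : ℕ) :
      ‖(Real.sqrt (((n : ℝ) + 1) * ((n : ℝ) + 2)) : ℂ) * conj (c n) * c (n + 2)‖ =
        √((n : ℝ) + 2) * ‖c (n + 2)‖ * (√((n : ℝ) + 1) * ‖c n‖) := by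
    rw [norm_mul, norm_mul, RCLike.norm_conj, Complex.norm_real, Real.norm_of_nonneg (by positivity),
      Real.sqrt_mul (by positivity)]
    ring
  have hlow (n : ℕ) : (√((n : ℝ) + 1) * ‖c n‖) ^ 2 = n * ‖c n‖ ^ 2 + ‖c n‖ ^ 2 := by
    rw [mul_pow, Real.sq_sqrt (by positivity)]
    ring
  have hhigh (n : ℕ) :
      (√((n : ℝ) + 2) * ‖c (n + 2)‖) ^ 2 = ((n + 2 : ℕ) : ℝ) * ‖c (n + 2)‖ ^ 2 := by
    rw [mul_pow, Real.sq_sqrt (by positivity)]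
    push_cast
    rfl
  have hshift : Summable fun n : ℕ => ((n + 2 : ℕ) : ℝ) * ‖c (n + 2)‖ ^ 2 :=
    (summable_nat_add_iff 2).2 hN
  have hshift_le :
      ∑' n : ℕ, ((n + 2 : ℕ) : ℝ) * ‖c (n + 2)‖ ^ 2 ≤ ∑' n : ℕ, (n : ℝ) * ‖c n‖ ^ 2 := by
    rw [← hN.sum_add_tsum_nat_add 2]
    exact le_add_of_nonneg_left (Finset.sum_nonneg fun n _ => by positivity)
  obtain ⟨hs, hle⟩ := Real.summable_mul_and_tsum_mul_le_sqrt
    (f := fun n : ℕ => √((n : ℝ) + 2) * ‖c (n + 2)‖) (g := fun n : ℕ => √((n : ℝ) + 1) * ‖c n‖)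
    (fun n => by positivity) (fun n => by positivity)
    (by simpa only [hhigh] using hshift) (by simpa only [hlow] using hN.add hsum)
  simp only [hlow, hhigh, hN.tsum_add hsum, hnorm] at hle
  simp only [← hterm] at hs hle
  refine ⟨hs, (norm_tsum_le_tsum_norm hs).trans (hle.trans (Real.sqrt_le_sqrt ?_))⟩
  have hN0 : 0 ≤ ∑' n : ℕ, (n : ℝ) * ‖c n‖ ^ 2 := tsum_nonneg fun n => by positivity
  gcongr
end

section
/- Let A ≥ 0 and 0 ≤ M ≤ √(A(A+1)) be real numbers, and define f : [0,∞) → ℝ by f(n) = A·n + (A+n)/2 − M·√(n(n+1)). Define n* = (1 + 4A(A+1) − 4M² − √((2A+1)²·((2A+1)² − 4M²))) / (8M² − 2(2A+1)²). Then the denominator 8M² − 2(2A+1)² is strictly negative, n* ≥ 0, and n* is the unique global minimizer of f on [0,∞): f(n*) ≤ f(n) for all n ≥ 0, with equality only at n = n*. -/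
/-- A form of the reverse Cauchy-Schwarz inequality on the unit hyperbola `x ^ 2 - y ^ 2 = 1`. -/
theorem le_mul_sub_mul_of_sq_sub_sq_eq_one {b c s x y : ℝ} (hs : s ^ 2 = b ^ 2 - c ^ 2)
    (hb : 0 < b) (hx : 0 ≤ x) (hxy : x ^ 2 - y ^ 2 = 1) : s ≤ b * x - c * y := by
  have hprod : (c * y) ^ 2 ≤ (b * x) ^ 2 := by
    have hc : c ^ 2 ≤ b ^ 2 := by nlinarith [sq_nonneg s]
    have hy : y ^ 2 ≤ x ^ 2 := by linarith
    rw [mul_pow, mul_pow]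
    exact mul_le_mul hc hy (sq_nonneg y) (sq_nonneg b)
  have hnonneg : 0 ≤ b * x - c * y :=
    sub_nonneg.2 (abs_le_of_sq_le_sq' hprod (mul_nonneg hb.le hx)).2
  have key : (b * x - c * y) ^ 2 = s ^ 2 + (b * y - c * x) ^ 2 := by
    linear_combination (b ^ 2 - c ^ 2) * hxy - hs
  exact (abs_le_of_sq_le_sq' (by nlinarith [sq_nonneg (b * y - c * x)]) hnonneg).2

/-- The equality case of `le_mul_sub_mul_of_sq_sub_sq_eq_one`. -/
theorem mul_eq_of_mul_sub_mul_eq {b c s x y : ℝ} (hs : s ^ 2 = b ^ 2 - c ^ 2)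
    (hs0 : 0 ≤ s) (hb : 0 < b) (hx : 0 ≤ x) (hxy : x ^ 2 - y ^ 2 = 1)
    (h : b * x - c * y = s) : s * x = b := by
  have hzero : (b * y - c * x) ^ 2 = 0 := by
    have h2 : (b * x - c * y) ^ 2 = s ^ 2 := by rw [h]
    linear_combination h2 - (b ^ 2 - c ^ 2) * hxy + hs
  have hyx : b * y - c * x = 0 := pow_eq_zero_iff two_ne_zero |>.1 hzero
  have hsq : (s * x) ^ 2 = b ^ 2 := by
    linear_combination x ^ 2 * hs + b ^ 2 * hxy + (b * y + c * x) * hyx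
  exact (sq_eq_sq₀ (mul_nonneg hs0 hx) hb.le).1 hsq


/-- **Optimal pump photon number in the small-angle limit.** For `A ≥ 0` and
`0 ≤ M ≤ √(A(A+1))`, the function `f(n) = A·n + (A+n)/2 − M·√(n(n+1))` on `[0,∞)`
has the unique global minimizer
`n* = (1 + 4A(A+1) − 4M² − √((2A+1)²((2A+1)² − 4M²))) / (8M² − 2(2A+1)²)`,
whose denominator is strictly negative and which satisfies `n* ≥ 0`. -/
theorem optimal_pump_photon_number (A M : ℝ) (hA : 0 ≤ A) (hM0 : 0 ≤ M)
    (hM : M ≤ Real.sqrt (A * (A + 1)))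
    (f : ℝ → ℝ)
    (hf : ∀ n : ℝ, f n = A * n + (A + n) / 2 - M * Real.sqrt (n * (n + 1)))
    (nstar : ℝ)
    (hnstar : nstar =
      (1 + 4 * A * (A + 1) - 4 * M ^ 2 -
          Real.sqrt ((2 * A + 1) ^ 2 * ((2 * A + 1) ^ 2 - 4 * M ^ 2))) /
        (8 * M ^ 2 - 2 * (2 * A + 1) ^ 2)) :
    8 * M ^ 2 - 2 * (2 * A + 1) ^ 2 < 0 ∧
    0 ≤ nstar ∧
    (∀ n : ℝ, 0 ≤ n → f nstar ≤ f n) ∧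
    (∀ n : ℝ, 0 ≤ n → f nstar = f n → n = nstar) := by
  obtain ⟨s, hs⟩ : ∃ s, s = Real.sqrt ((2 * A + 1) ^ 2 - 4 * M ^ 2) := ⟨_, rfl⟩
  have hM2 : M ^ 2 ≤ A * (A + 1) := (Real.le_sqrt hM0 (by positivity)).1 hM
  have hb : 0 < 2 * A + 1 := by linarith
  have hs1 : 1 ≤ s := hs ▸ Real.one_le_sqrt.2 (by nlinarith)
  have hs0 : 0 < s := by linarith
  have hs2 : s ^ 2 = (2 * A + 1) ^ 2 - (2 * M) ^ 2 := by
    rw [hs, Real.sq_sqrt (by nlinarith)]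
    ring
  have hroot : Real.sqrt ((2 * A + 1) ^ 2 * ((2 * A + 1) ^ 2 - 4 * M ^ 2)) = (2 * A + 1) * s := by
    rw [Real.sqrt_mul (sq_nonneg _), Real.sqrt_sq hb.le, ← hs]
  have hden : 8 * M ^ 2 - 2 * (2 * A + 1) ^ 2 = -2 * s ^ 2 := by linear_combination 2 * hs2
  have hnum : 1 + 4 * A * (A + 1) - 4 * M ^ 2 = s ^ 2 := by linear_combination -hs2
  have hn : s * (2 * nstar + 1) = 2 * A + 1 := by
    rw [hnstar, hroot, hden, hnum]
    field_simp
    ring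
  have hsb : s ≤ 2 * A + 1 :=
    (abs_le_of_sq_le_sq' (by nlinarith [sq_nonneg (2 * M)]) hb.le).2
  have hn0 : 0 ≤ nstar := by
    by_contra! hneg
    nlinarith [mul_neg_of_pos_of_neg hs0 hneg]
  have hhyp : ∀ n : ℝ, 0 ≤ n → (2 * n + 1) ^ 2 - (2 * Real.sqrt (n * (n + 1))) ^ 2 = 1 := by
    intro n hn
    rw [mul_pow, Real.sq_sqrt (by positivity)]
    ring
  have hform : ∀ n : ℝ, f n =
      ((2 * A + 1) * (2 * n + 1) - 2 * M * (2 * Real.sqrt (n * (n + 1))) - 1) / 4 := by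
    intro n
    rw [hf]
    ring
  have hy : s * (2 * Real.sqrt (nstar * (nstar + 1))) = 2 * M := by
    refine (sq_eq_sq₀ (by positivity) (by positivity)).1 ?_
    linear_combination
      (s * (2 * nstar + 1) + (2 * A + 1)) * hn - s ^ 2 * hhyp nstar hn0 - hs2
  have hmin : f nstar = (s - 1) / 4 := by
    rw [hform]
    refine mul_left_cancel₀ hs0.ne' ?_
    linear_combination (2 * A + 1) / 4 * hn - M / 2 * hy - hs2 / 4
  refine ⟨by rw [hden]; nlinarith, hn0, fun n hn' => ?_, fun n hn' heq => ?_⟩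
  · rw [hmin, hform]
    linarith [le_mul_sub_mul_of_sq_sub_sq_eq_one hs2 hb (by linarith) (hhyp n hn')]
  · rw [hmin, hform] at heq
    have hx := mul_eq_of_mul_sub_mul_eq hs2 hs0.le hb (by linarith) (hhyp n hn')
      (by linarith)
    linarith [mul_left_cancel₀ hs0.ne' (hx.trans hn.symm)]
end

section
/- For every α > 0: ∫_ℝ π^{−1/4} e^{−x²/2} · (sinc(x/α)/√(α π)) dx = π^{1/4} · √α · erf(1/(√2 · α)), where sinc t = sin t / t for t ≠ 0, sinc 0 = 1, and erf(z) = (2/√π) ∫₀^z e^{−t²} dt. -/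
/-- The (unnormalized) sinc function: `sinc t = sin t / t` for `t ≠ 0`, `sinc 0 = 1`. -/
noncomputable def sinc (t : ℝ) : ℝ := if t = 0 then 1 else Real.sin t / t

/-- The error function `erf z = (2/√π) ∫₀^z e^{−t²} dt`. -/
noncomputable def erf (z : ℝ) : ℝ :=
  (2 / Real.sqrt Real.pi) * ∫ t in (0 : ℝ)..z, Real.exp (-t ^ 2)

/-- `sinc` is the average of `cos (s * t)` over `s ∈ [0, 1]`. -/
theorem integral_cos_mul_eq_sinc (t : ℝ) : ∫ s in (0 : ℝ)..1, Real.cos (s * t) = sinc t := by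
  unfold sinc
  split_ifs with h
  · simp [h]
  · simp [intervalIntegral.integral_comp_mul_right (fun x => Real.cos x) h, integral_cos,
      div_eq_inv_mul]

/-- The Fourier cosine transform of the unit-width Gaussian. -/
theorem integral_cos_mul_exp_neg_sq_div_two (t : ℝ) :
    ∫ x : ℝ, Real.cos (t * x) * Real.exp (-x ^ 2 / 2) =
      Real.sqrt (2 * Real.pi) * Real.exp (-t ^ 2 / 2) := by
  have hb : 0 < (1 / 2 : ℂ).re := by norm_num
  have hre : ∀ x : ℝ, Real.cos (t * x) * Real.exp (-x ^ 2 / 2) =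
      RCLike.re (Complex.exp (Complex.I * t * x) * Complex.exp (-(1 / 2) * (x : ℂ) ^ 2)) := by
    intro x
    have h₁ : Complex.I * t * x = ((t * x : ℝ) : ℂ) * Complex.I := by push_cast; ring
    have h₂ : -(1 / 2) * (x : ℂ) ^ 2 = ((-x ^ 2 / 2 : ℝ) : ℂ) := by push_cast; ring
    rw [h₁, h₂, ← Complex.ofReal_exp]
    simp only [RCLike.re_eq_complex_re, Complex.re_mul_ofReal, Complex.exp_ofReal_mul_I_re]
  have hint : MeasureTheory.Integrable fun x : ℝ =>
      Complex.exp (Complex.I * t * x) * Complex.exp (-(1 / 2) * (x : ℂ) ^ 2) := by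
    refine (integrable_cexp_quadratic hb (Complex.I * t) 0).congr (.of_forall fun x => ?_)
    simp only
    rw [← Complex.exp_add]
    ring_nf
  have h₁ : -(t : ℂ) ^ 2 / (4 * (1 / 2)) = ((-t ^ 2 / 2 : ℝ) : ℂ) := by push_cast; ring
  have h₂ : ((Real.pi : ℂ) / (1 / 2)) ^ (1 / 2 : ℂ) = ((Real.sqrt (2 * Real.pi) : ℝ) : ℂ) := by
    rw [Real.sqrt_eq_rpow, Complex.ofReal_cpow (by positivity)]
    push_cast
    ring_nf
  simp_rw [hre]
  rw [integral_re hint, fourierIntegral_gaussian hb, h₁, h₂, ← Complex.ofReal_exp,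
    ← Complex.ofReal_mul]
  rfl

/-- Integrating a Gaussian against `sinc` reduces to a Gaussian integral over `[0, 1]`. -/
theorem integral_exp_neg_sq_div_two_mul_sinc (c : ℝ) :
    ∫ x : ℝ, Real.exp (-x ^ 2 / 2) * sinc (x * c) =
      Real.sqrt (2 * Real.pi) * ∫ s in (0 : ℝ)..1, Real.exp (-(s * c) ^ 2 / 2) := by
  have hg : MeasureTheory.Integrable fun x : ℝ => Real.exp (-x ^ 2 / 2) := by
    refine (integrable_exp_neg_mul_sq (b := 1 / 2) (by norm_num)).congr (.of_forall fun x => ?_)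
    simp only
    ring_nf
  have hint : MeasureTheory.Integrable
      (Function.uncurry fun s x : ℝ => Real.cos (s * c * x) * Real.exp (-x ^ 2 / 2))
      ((MeasureTheory.volume.restrict (Set.uIoc (0 : ℝ) 1)).prod MeasureTheory.volume) := by
    have : MeasureTheory.IsFiniteMeasure
        (MeasureTheory.volume.restrict (Set.uIoc (0 : ℝ) 1)) := by
      rw [Set.uIoc_of_le zero_le_one]; infer_instance
    refine (hg.comp_snd _).bdd_mul (c := 1)
      (f := fun z : ℝ × ℝ => Real.cos (z.1 * c * z.2)) ?_ (.of_forall fun z => ?_)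
    · exact Continuous.aestronglyMeasurable (by fun_prop)
    · exact Real.abs_cos_le_one _
  calc
    _ = ∫ x : ℝ, ∫ s in (0 : ℝ)..1, Real.cos (s * c * x) * Real.exp (-x ^ 2 / 2) := by
      congr 1 with x
      rw [intervalIntegral.integral_mul_const, ← integral_cos_mul_eq_sinc, mul_comm]
      simp only [mul_assoc, mul_comm c x]
    _ = ∫ s in (0 : ℝ)..1, ∫ x : ℝ, Real.cos (s * c * x) * Real.exp (-x ^ 2 / 2) :=
      (MeasureTheory.intervalIntegral_integral_swap hint).symm
    _ = _ := by
      simp_rw [integral_cos_mul_exp_neg_sq_div_two]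
      rw [intervalIntegral.integral_const_mul]

/-- A Gaussian integral over `[0, 1]` in terms of the error function. -/
theorem integral_exp_neg_mul_sq_eq_erf {c : ℝ} (hc : c ≠ 0) :
    ∫ s in (0 : ℝ)..1, Real.exp (-(s * c) ^ 2) = Real.sqrt Real.pi / (2 * c) * erf c := by
  have hpi : Real.sqrt Real.pi ≠ 0 := by positivity
  rw [intervalIntegral.integral_comp_mul_right (fun x => Real.exp (-x ^ 2)) hc, erf]
  simp only [zero_mul, one_mul, smul_eq_mul]
  field_simp

/-- **Gaussian–sinc overlap.** For every `α > 0`,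
`∫ π^{−1/4} e^{−x²/2} · sinc(x/α)/√(απ) dx = π^{1/4} √α · erf(1/(√2 α))`. -/
theorem gaussian_sinc_overlap (α : ℝ) (hα : 0 < α) :
    (∫ x : ℝ, Real.pi ^ (-(1 / 4 : ℝ)) * Real.exp (-x ^ 2 / 2) *
        (sinc (x / α) / Real.sqrt (α * Real.pi)))
      = Real.pi ^ ((1 / 4 : ℝ)) * Real.sqrt α * erf (1 / (Real.sqrt 2 * α)) := by
  have hπ := Real.pi_pos
  have hexp : ∀ s : ℝ, -(s * α⁻¹) ^ 2 / 2 = -(s * (1 / (Real.sqrt 2 * α))) ^ 2 := by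
    intro s
    simp only [mul_pow, div_pow, inv_pow, Real.sq_sqrt (zero_le_two : (0 : ℝ) ≤ 2)]
    field_simp
  have hquarter : Real.pi ^ (-(1 / 4 : ℝ)) = Real.pi ^ (1 / 4 : ℝ) / Real.sqrt Real.pi := by
    rw [Real.sqrt_eq_rpow, ← Real.rpow_sub hπ]
    norm_num
  have hfactor : ∀ x : ℝ, Real.pi ^ (-(1 / 4 : ℝ)) * Real.exp (-x ^ 2 / 2) *
      (sinc (x / α) / Real.sqrt (α * Real.pi)) =
      Real.pi ^ (-(1 / 4 : ℝ)) / Real.sqrt (α * Real.pi) *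
        (Real.exp (-x ^ 2 / 2) * sinc (x * α⁻¹)) := by
    intro x
    rw [div_eq_mul_inv x]
    ring
  simp_rw [hfactor]
  rw [MeasureTheory.integral_const_mul, integral_exp_neg_sq_div_two_mul_sinc]
  simp_rw [hexp]
  rw [integral_exp_neg_mul_sq_eq_erf (by positivity), hquarter, Real.sqrt_mul hα.le,
    Real.sqrt_mul zero_le_two]
  field_simp
  rw [Real.sq_sqrt zero_le_two, Real.sq_sqrt hα.le]
  ring
end
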